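/- Let a < b, let E, ρ : [a,b] → ℝ be continuously differentiable with ρ > 0, let k > 0, and for i = 1, 2 let wⁱ, pⁱ : ℝ × [a,b] → ℝ be twice continuously differentiable with ∂ₜwⁱ = pⁱ/ρ and ∂ₜpⁱ = ∂ₓ(E ∂ₓ wⁱ) on [a,b]. Define the boundary inputs ν¹₁(t) := −E(a) ∂ₓw¹(t,a), ν¹₂(t) := E(b) ∂ₓw¹(t,b) − k( w²(t,a) − w¹(t,b) ), ν²₁(t) := −E(a) ∂ₓw²(t,a) − k( w¹(t,b) − w²(t,a) ), ν²₂(t) := E(b) ∂ₓw²(t,b). Then the total Hamiltonian H̃(t) := (1/2) Σ_{i=1,2} ∫ₐᵇ ( (pⁱ)²/ρ + E (∂ₓwⁱ)² ) dx + (k/2)( w¹(t,b) − w²(t,a) )² is differentiable and H̃'(t) = ∂ₜw¹(t,a) ν¹₁(t) + ∂ₜw¹(t,b) ν¹₂(t) + ∂ₜw²(t,a) ν²₁(t) + ∂ₜw²(t,b) ν²₂(t). In particular, if ν¹₁ = ν²₂ = 0 and ν¹₂(t) = −γ ∂ₜw¹(t,b), ν²₁(t) = −γ ∂ₜw²(t,a)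 for some γ > 0, then H̃'(t) ≤ 0 for all t. -/

import Mathlib

open Set MeasureTheory intervalIntegral

section StripCalculus

variable {G : Type*} [NormedAddCommGroup G] [NormedSpace ℝ G]

theorem uniqueDiffOn_univ_prod_Icc {a b : ℝ} (hab : a < b) :
    UniqueDiffOn ℝ ((univ : Set ℝ) ×ˢ Icc a b) :=
  uniqueDiffOn_univ.prod (uniqueDiffOn_Icc hab)

theorem hasDerivAt_fst_of_differentiableOn_strip {a b : ℝ} {f : ℝ × ℝ → G}
    (hf : DifferentiableOn ℝ f (univ ×ˢ Icc a b)) (t : ℝ) {x : ℝ} (hx : x ∈ Icc a b) :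
    HasDerivAt (fun s => f (s, x)) (fderivWithin ℝ f (univ ×ˢ Icc a b) (t, x) (1, 0)) t :=
  (hf (t, x) ⟨mem_univ _, hx⟩).hasFDerivWithinAt.comp_hasDerivAt (f := fun s : ℝ => (s, x)) t
    ((hasDerivAt_id t).prodMk (hasDerivAt_const t x))
    (Filter.Eventually.of_forall fun s => (⟨mem_univ s, hx⟩ : (s, x) ∈ univ ×ˢ Icc a b))

theorem hasDerivWithinAt_snd_of_differentiableOn_strip {a b : ℝ} {f : ℝ × ℝ → G}
    (hf : DifferentiableOn ℝ f (univ ×ˢ Icc a b)) (t : ℝ) {x : ℝ} (hx : x ∈ Icc a b) :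
    HasDerivWithinAt (fun y => f (t, y)) (fderivWithin ℝ f (univ ×ˢ Icc a b) (t, x) (0, 1))
      (Icc a b) x :=
  (hf (t, x) ⟨mem_univ _, hx⟩).hasFDerivWithinAt.comp_hasDerivWithinAt x
    ((hasDerivWithinAt_const x _ t).prodMk (hasDerivWithinAt_id x _))
    (fun _ hy => ⟨mem_univ _, hy⟩)

/-- Differentiation under the integral sign over a compact interval, for an integrand whose
derivative in the parameter is jointly continuous. -/
theorem hasDerivAt_integral_of_continuousOn_strip {a b : ℝ} (hab : a ≤ b) {f f' : ℝ → ℝ → ℝ}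
    (hf : ∀ t, ContinuousOn (f t) (Icc a b))
    (hf' : ContinuousOn (fun q : ℝ × ℝ => f' q.1 q.2) (univ ×ˢ Icc a b))
    (hderiv : ∀ t, ∀ x ∈ Icc a b, HasDerivAt (fun s => f s x) (f' t x) t) (t : ℝ) :
    HasDerivAt (fun s => ∫ x in a..b, f s x) (∫ x in a..b, f' t x) t := by
  have hsub : uIoc a b ⊆ Icc a b := by rw [uIoc_of_le hab]; exact Ioc_subset_Icc_self
  have hmeas : ∀ g : ℝ → ℝ, ContinuousOn g (Icc a b) →
      AEStronglyMeasurable g (volume.restrict (uIoc a b)) := fun g hg =>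
    (hg.mono hsub).aestronglyMeasurable measurableSet_uIoc
  have hf't : ContinuousOn (f' t) (Icc a b) :=
    hf'.comp (f := fun x : ℝ => (t, x)) (by fun_prop) (fun x hx => ⟨mem_univ _, hx⟩)
  obtain ⟨C, hC⟩ := ((isCompact_Icc (a := t - 1) (b := t + 1)).prod
    (isCompact_Icc (a := a) (b := b))).exists_bound_of_continuousOn
      (hf'.mono (prod_mono (subset_univ _) le_rfl))
  refine (hasDerivAt_integral_of_dominated_loc_of_deriv_le (bound := fun _ => C)
    (Icc_mem_nhds (by linarith) (by linarith) : Icc (t - 1) (t + 1) ∈ nhds t)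
    (Filter.Eventually.of_forall fun s => hmeas _ (hf s))
    ((hf t).intervalIntegrable_of_Icc hab) (hmeas _ hf't)
    (Filter.Eventually.of_forall fun x hx s hs => hC (s, x) ⟨hs, hsub hx⟩)
    intervalIntegrable_const
    (Filter.Eventually.of_forall fun x hx s _ => hderiv s x (hsub hx))).2

end StripCalculus

/-- Energy balance of a single wave equation: the energy changes at the rate at which power flows
through the two boundary points. -/
theorem hasDerivAt_wave_energy {a b : ℝ} (hab : a < b) {E ρ : ℝ → ℝ}
    (hE : ContDiffOn ℝ 1 E (Icc a b)) (hρ : ContDiffOn ℝ 1 ρ (Icc a b))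
    (hρpos : ∀ x ∈ Icc a b, 0 < ρ x) {w p : ℝ → ℝ → ℝ}
    (hw : ContDiffOn ℝ 2 (fun q : ℝ × ℝ => w q.1 q.2) (univ ×ˢ Icc a b))
    (hp : ContDiffOn ℝ 2 (fun q : ℝ × ℝ => p q.1 q.2) (univ ×ˢ Icc a b))
    (hwt : ∀ t : ℝ, ∀ x ∈ Icc a b, HasDerivAt (fun s => w s x) (p t x / ρ x) t)
    (hpt : ∀ t : ℝ, ∀ x ∈ Icc a b,
      HasDerivAt (fun s => p s x)
        (derivWithin (fun y => E y * derivWithin (w t) (Icc a b) y) (Icc a b) x) t)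
    (t : ℝ) :
    HasDerivAt
      (fun s => ∫ x in a..b, ((p s x) ^ 2 / ρ x + E x * (derivWithin (w s) (Icc a b) x) ^ 2))
      (2 * (p t b / ρ b * (E b * derivWithin (w t) (Icc a b) b)
        - p t a / ρ a * (E a * derivWithin (w t) (Icc a b) a))) t := by
  set S : Set (ℝ × ℝ) := univ ×ˢ Icc a b with hS
  have hSu : UniqueDiffOn ℝ S := uniqueDiffOn_univ_prod_Icc hab
  have hu := uniqueDiffOn_Icc hab
  set W : ℝ × ℝ → ℝ := fun q => w q.1 q.2 with hW
  set P : ℝ × ℝ → ℝ := fun q => p q.1 q.2 with hP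
  set D := fderivWithin ℝ W S with hD
  have hDc : ContDiffOn ℝ 1 D S := hw.fderivWithin hSu (by norm_num)
  have hDd : DifferentiableOn ℝ D S := hDc.differentiableOn (by norm_num)
  set D2 := fderivWithin ℝ D S with hD2
  have hD2c : ContinuousOn D2 S := hDc.continuousOn_fderivWithin hSu le_rfl
  have hWd : DifferentiableOn ℝ W S := hw.differentiableOn (by norm_num)
  have hPd : DifferentiableOn ℝ P S := hp.differentiableOn (by norm_num)
  have hslice : ∀ s, MapsTo (fun x : ℝ => (s, x)) (Icc a b) S := fun s x hx => ⟨mem_univ _, hx⟩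
  have hsymm : ∀ s, ∀ x ∈ Icc a b, D2 (s, x) (1, 0) (0, 1) = D2 (s, x) (0, 1) (1, 0) := by
    intro s x hx
    refine (hw (s, x) ⟨mem_univ _, hx⟩).isSymmSndFDerivWithinAt (by simp) hSu ?_
      ⟨mem_univ _, hx⟩ _ _
    rw [hS, interior_prod_eq, closure_prod_eq, interior_univ, interior_Icc, closure_univ,
      closure_Ioo hab.ne]
    exact ⟨mem_univ _, hx⟩
  have hwx : ∀ s, ∀ x ∈ Icc a b, derivWithin (w s) (Icc a b) x = D (s, x) (0, 1) := fun s x hx =>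
    (hasDerivWithinAt_snd_of_differentiableOn_strip hWd s hx).derivWithin (hu x hx)
  have hvel : ∀ s, ∀ x ∈ Icc a b, p s x / ρ x = D (s, x) (1, 0) := fun s x hx =>
    (hwt s x hx).unique (hasDerivAt_fst_of_differentiableOn_strip hWd s hx)
  have hwx_t : ∀ s, ∀ x ∈ Icc a b, HasDerivAt (fun r => derivWithin (w r) (Icc a b) x)
      (D2 (s, x) (1, 0) (0, 1)) s := by
    intro s x hx
    have h := (hasDerivAt_fst_of_differentiableOn_strip hDd s hx).clm_apply
      (hasDerivAt_const s ((0, 1) : ℝ × ℝ))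
    simp only [map_zero, add_zero] at h
    exact h.congr_of_eventuallyEq (Filter.Eventually.of_forall fun r => hwx r x hx)
  have hvel_x : ∀ s, ∀ x ∈ Icc a b, HasDerivWithinAt (fun y => p s y / ρ y)
      (D2 (s, x) (1, 0) (0, 1)) (Icc a b) x := by
    intro s x hx
    have h := (hasDerivWithinAt_snd_of_differentiableOn_strip hDd s hx).clm_apply
      (hasDerivWithinAt_const x (Icc a b) ((1, 0) : ℝ × ℝ))
    simp only [map_zero, add_zero] at h
    rw [hsymm s x hx]
    exact h.congr (fun y hy => hvel s y hy) (hvel s x hx)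
  have hflux_x : ∀ s, ∀ x ∈ Icc a b,
      HasDerivWithinAt (fun y => E y * derivWithin (w s) (Icc a b) y)
        (fderivWithin ℝ P S (s, x) (1, 0)) (Icc a b) x := by
    intro s x hx
    have hd : DifferentiableWithinAt ℝ (fun y => derivWithin (w s) (Icc a b) y) (Icc a b) x := by
      have h := (hasDerivWithinAt_snd_of_differentiableOn_strip hDd s hx).clm_apply
        (hasDerivWithinAt_const x (Icc a b) ((0, 1) : ℝ × ℝ))
      exact (h.congr (fun y hy => hwx s y hy) (hwx s x hx)).differentiableWithinAt
    rw [← (hpt s x hx).unique (hasDerivAt_fst_of_differentiableOn_strip hPd s hx)]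
    exact (((hE.differentiableOn (by norm_num)) x hx).mul hd).hasDerivWithinAt
  have hPt : ∀ s, ∀ x ∈ Icc a b, HasDerivAt (fun r => p r x)
      (fderivWithin ℝ P S (s, x) (1, 0)) s := fun s x hx =>
    hasDerivAt_fst_of_differentiableOn_strip hPd s hx
  have hPtc : ContinuousOn (fun q => fderivWithin ℝ P S q (1, 0)) S :=
    (hp.continuousOn_fderivWithin hSu (by norm_num)).clm_apply continuousOn_const
  have hsnd : MapsTo (Prod.snd : ℝ × ℝ → ℝ) S (Icc a b) := fun q hq => hq.2
  have hEc : ContinuousOn (fun q : ℝ × ℝ => E q.2) S :=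
    hE.continuousOn.comp continuousOn_snd hsnd
  have hρc : ContinuousOn (fun q : ℝ × ℝ => ρ q.2) S :=
    hρ.continuousOn.comp continuousOn_snd hsnd
  have hwxc : ContinuousOn (fun q : ℝ × ℝ => derivWithin (w q.1) (Icc a b) q.2) S :=
    (hDc.continuousOn.clm_apply (continuousOn_const (c := ((0, 1) : ℝ × ℝ)))).congr
      fun q hq => hwx q.1 q.2 hq.2
  have hmixc : ContinuousOn (fun q => D2 q (1, 0) (0, 1)) S :=
    (hD2c.clm_apply continuousOn_const).clm_apply continuousOn_const
  have hvelc : ContinuousOn (fun q : ℝ × ℝ => p q.1 q.2 / ρ q.2) S :=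
    hp.continuousOn.div hρc fun q hq => (hρpos _ hq.2).ne'
  have hec : ContinuousOn (fun q : ℝ × ℝ => (p q.1 q.2) ^ 2 / ρ q.2
      + E q.2 * (derivWithin (w q.1) (Icc a b) q.2) ^ 2) S :=
    ((hp.continuousOn.pow 2).div hρc fun q hq => (hρpos _ hq.2).ne').add (hEc.mul (hwxc.pow 2))
  let e' : ℝ → ℝ → ℝ := fun s x =>
    2 * (D2 (s, x) (1, 0) (0, 1) * (E x * derivWithin (w s) (Icc a b) x)
      + p s x / ρ x * fderivWithin ℝ P S (s, x) (1, 0))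
  have he'c : ContinuousOn (fun q : ℝ × ℝ => e' q.1 q.2) S :=
    continuousOn_const.mul ((hmixc.mul (hEc.mul hwxc)).add (hvelc.mul hPtc))
  have hleib := hasDerivAt_integral_of_continuousOn_strip hab.le (f' := e')
    (fun s => hec.comp (f := fun x : ℝ => (s, x)) (by fun_prop) (hslice s)) he'c
    (fun s x hx => by
      refine ((((hPt s x hx).pow 2).div_const (ρ x)).add
        (((hwx_t s x hx).pow 2).const_mul (E x))).congr_deriv ?_
      simp only [e']
      push_cast
      ring) t
  refine hleib.congr_deriv ?_
  have hftc := integral_eq_sub_of_hasDerivAt_of_le hab.le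
    (f := fun x => 2 * (p t x / ρ x * (E x * derivWithin (w t) (Icc a b) x))) (f' := e' t)
    (fun x hx => (((hvel_x t x hx).mul (hflux_x t x hx)).const_mul 2).continuousWithinAt)
    (fun x hx => (((hvel_x t x (Ioo_subset_Icc_self hx)).mul
      (hflux_x t x (Ioo_subset_Icc_self hx))).const_mul 2).hasDerivAt (Icc_mem_nhds hx.1 hx.2))
    ((he'c.comp (f := fun x : ℝ => (t, x)) (by fun_prop) (hslice t)).intervalIntegrable_of_Icc
      hab.le)
  rw [hftc]
  ring

/-- Energy-port interconnection of two 1D wave equations through a spring potential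
`V = (k/2)(w¹(b) − w²(a))²`: the total Hamiltonian `H̃ = H¹ + H² + V` satisfies the
power balance `H̃' = Σ ∂ₜwⁱ(boundary)·νⁱ(boundary)`, and with dissipative feedback
`ν¹₂ = −γ∂ₜw¹(b)`, `ν²₁ = −γ∂ₜw²(a)` (and `ν¹₁ = ν²₂ = 0`) one gets `H̃' ≤ 0`. -/
theorem coupled_waves_spring_power_balance
    (a b : ℝ) (hab : a < b)
    (E ρ : ℝ → ℝ)
    (hE : ContDiffOn ℝ 1 E (Icc a b))
    (hρ : ContDiffOn ℝ 1 ρ (Icc a b))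
    (hρpos : ∀ x ∈ Icc a b, 0 < ρ x)
    (k : ℝ) (hk : 0 < k)
    (w₁ p₁ w₂ p₂ : ℝ → ℝ → ℝ)
    (hw₁ : ContDiffOn ℝ 2 (fun q : ℝ × ℝ => w₁ q.1 q.2) (univ ×ˢ Icc a b))
    (hp₁ : ContDiffOn ℝ 2 (fun q : ℝ × ℝ => p₁ q.1 q.2) (univ ×ˢ Icc a b))
    (hw₂ : ContDiffOn ℝ 2 (fun q : ℝ × ℝ => w₂ q.1 q.2) (univ ×ˢ Icc a b))
    (hp₂ : ContDiffOn ℝ 2 (fun q : ℝ × ℝ => p₂ q.1 q.2) (univ ×ˢ Icc a b))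
    (heq1₁ : ∀ t : ℝ, ∀ x ∈ Icc a b, HasDerivAt (fun s => w₁ s x) (p₁ t x / ρ x) t)
    (heq2₁ : ∀ t : ℝ, ∀ x ∈ Icc a b,
      HasDerivAt (fun s => p₁ s x)
        (derivWithin (fun y => E y * derivWithin (fun z => w₁ t z) (Icc a b) y) (Icc a b) x) t)
    (heq1₂ : ∀ t : ℝ, ∀ x ∈ Icc a b, HasDerivAt (fun s => w₂ s x) (p₂ t x / ρ x) t)
    (heq2₂ : ∀ t : ℝ, ∀ x ∈ Icc a b,
      HasDerivAt (fun s => p₂ s x)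
        (derivWithin (fun y => E y * derivWithin (fun z => w₂ t z) (Icc a b) y) (Icc a b) x) t) :
    let Dx : (ℝ → ℝ) → ℝ → ℝ := fun f x => derivWithin f (Icc a b) x
    let Dt : (ℝ → ℝ → ℝ) → ℝ → ℝ → ℝ := fun f t x => deriv (fun s => f s x) t
    let ν₁₁ : ℝ → ℝ := fun t => -(E a * Dx (w₁ t) a)
    let ν₁₂ : ℝ → ℝ := fun t => E b * Dx (w₁ t) b - k * (w₂ t a - w₁ t b)
    let ν₂₁ : ℝ → ℝ := fun t => -(E a * Dx (w₂ t) a) - k * (w₁ t b - w₂ t a)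
    let ν₂₂ : ℝ → ℝ := fun t => E b * Dx (w₂ t) b
    let Htot : ℝ → ℝ := fun t =>
      (1/2) * ((∫ x in a..b, ((p₁ t x)^2 / ρ x + E x * (Dx (w₁ t) x)^2))
        + (∫ x in a..b, ((p₂ t x)^2 / ρ x + E x * (Dx (w₂ t) x)^2)))
      + (k/2) * (w₁ t b - w₂ t a)^2
    (∀ t : ℝ,
      HasDerivAt Htot
        (Dt w₁ t a * ν₁₁ t + Dt w₁ t b * ν₁₂ t + Dt w₂ t a * ν₂₁ t + Dt w₂ t b * ν₂₂ t) t) ∧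
    (∀ γ : ℝ, 0 < γ →
      (∀ t : ℝ, ν₁₁ t = 0) → (∀ t : ℝ, ν₂₂ t = 0) →
      (∀ t : ℝ, ν₁₂ t = -γ * Dt w₁ t b) → (∀ t : ℝ, ν₂₁ t = -γ * Dt w₂ t a) →
      ∀ t : ℝ, deriv Htot t ≤ 0) := by
  intro Dx Dt ν₁₁ ν₁₂ ν₂₁ ν₂₂ Htot
  have ha : a ∈ Icc a b := left_mem_Icc.2 hab.le
  have hb : b ∈ Icc a b := right_mem_Icc.2 hab.le
  have hbalance : ∀ t : ℝ, HasDerivAt Htot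
      (Dt w₁ t a * ν₁₁ t + Dt w₁ t b * ν₁₂ t + Dt w₂ t a * ν₂₁ t + Dt w₂ t b * ν₂₂ t) t := by
    intro t
    have h₁ := hasDerivAt_wave_energy hab hE hρ hρpos hw₁ hp₁ heq1₁ heq2₁ t
    have h₂ := hasDerivAt_wave_energy hab hE hρ hρpos hw₂ hp₂ heq1₂ heq2₂ t
    have hV := (((heq1₁ t b hb).sub (heq1₂ t a ha)).pow 2).const_mul (k / 2)
    refine (((h₁.add h₂).const_mul (1 / 2)).add hV).congr_deriv ?_
    simp only [Dt, Dx, ν₁₁, ν₁₂, ν₂₁, ν₂₂, (heq1₁ t a ha).deriv, (heq1₁ t b hb).deriv,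
      (heq1₂ t a ha).deriv, (heq1₂ t b hb).deriv, Pi.sub_apply]
    push_cast
    ring
  refine ⟨hbalance, fun γ hγ h₁₁ h₂₂ h₁₂ h₂₁ t => ?_⟩
  rw [(hbalance t).deriv, h₁₁, h₂₂, h₁₂, h₂₁]
  nlinarith [mul_nonneg hγ.le (sq_nonneg (Dt w₁ t b)), mul_nonneg hγ.le (sq_nonneg (Dt w₂ t a))]
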